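/- If ν ∈ ℝ^c satisfies Nᵀ ν = Nᵀ B, then there exists u ∈ ℝ^m such that A_i ⬝ u ≤ B_i for every index i with ν_i ≥ 0, and simultaneously A_i ⬝ u ≥ B_i for every index i with ν_i < 0; i.e., the constraint set obtained by keeping the constraints with nonnegative ν-components and reversing the inequalities of the constraints with negative ν-components is nonempty. -/

import Mathlib

open Matrix

/-- A vector orthogonal to the null space of `A` lies in the row space of `A`. -/
theorem exists_transpose_mulVec_eq {K m n : Type*} [Field K] [Fintype m] [Fintype n]
    (A : Matrix m n K) (w : n → K) (hw : ∀ l, A *ᵥ l = 0 → l ⬝ᵥ w = 0) :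
    ∃ u, Aᵀ *ᵥ u = w := by
  classical
  change w ∈ LinearMap.range Aᵀ.mulVecLin
  rw [← Subspace.forall_mem_dualAnnihilator_apply_eq_zero_iff]
  intro φ hφ
  obtain ⟨l, rfl⟩ := (dotProductEquiv K n).surjective φ
  rw [Submodule.mem_dualAnnihilator] at hφ
  refine hw l (dotProduct_eq_zero _ fun u => ?_)
  have h : l ⬝ᵥ (Aᵀ *ᵥ u) = 0 := hφ _ ⟨u, rfl⟩
  rwa [dotProduct_mulVec, vecMul_transpose] at h

/-- If `Nᵀ ν = Nᵀ B`, then there exists `u` satisfying `A_i ⬝ u ≤ B_i` for all `i`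
with `ν_i ≥ 0` and `A_i ⬝ u ≥ B_i` for all `i` with `ν_i < 0`. -/
theorem stmt_11 (m c k : ℕ) (hm : 0 < m) (hc : 0 < c) (hk : 0 < k)
    (A : Matrix (Fin m) (Fin c) ℝ) (B : Fin c → ℝ)
    (N : Matrix (Fin c) (Fin k) ℝ)
    (hN : {l : Fin c → ℝ | A.mulVec l = 0} = {l : Fin c → ℝ | ∃ μ : Fin k → ℝ, l = N.mulVec μ})
    (ν : Fin c → ℝ) (hν : Nᵀ.mulVec ν = Nᵀ.mulVec B) :
    ∃ u : Fin m → ℝ, (∀ i, 0 ≤ ν i → Aᵀ.mulVec u i ≤ B i) ∧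
      (∀ i, ν i < 0 → B i ≤ Aᵀ.mulVec u i) := by
  obtain ⟨u, hu⟩ := exists_transpose_mulVec_eq A (B - ν) fun l hl => by
    obtain ⟨μ, rfl⟩ := hN.subset hl
    rw [← vecMul_transpose, ← dotProduct_mulVec, mulVec_sub, hν, sub_self, dotProduct_zero]
  refine ⟨u, fun i hi => ?_, fun i hi => ?_⟩ <;> rw [hu, Pi.sub_apply] <;> linarith
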